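/- arXiv:1310.2973 — 2 statements merged into one kernel-verified Lean document; each statement's English description precedes it below -/
import Mathlib

section
/- Let 0 < δ ≤ δ̄ and let C : [0,1] → Matrix (Fin D) (Fin D) ℝ be continuous with δ|y|² ≤ yᵀC(t)C(t)ᵀy ≤ δ̄|y|² for all y ∈ ℝ^D, t ∈ [0,1], Σ(t,s) := ∫_t^s C(u)C(u)ᵀ du, and Γ(t,s,y) := exp(−(1/2) yᵀΣ(t,s)⁻¹y)/((2π)^{D/2}(det Σ(t,s))^{1/2}). Let T ∈ (0,1], α ∈ (0,1), g : ℝ^D → ℝ be C¹ with bounded gradient, and f : [0,T]×ℝ^D → ℝ be bounded continuous with finite parabolic α-Hölder seminorm. Define u(t,y) := ∫_{ℝ^D} Γ(t,T,x−y)g(x)dx + ∫_t^T∫_{ℝ^D} Γ(t,s,x−y)f(s,x)dxds. Then there exists a constant c > 0 depending only on δ and D such that for every d ∈ {1,…,D}, u is partially differentiable in y_d on [0,T)×ℝ^D and sup_{(t,y)} |∂_{y_d}u(t,y)| ≤ sup_y|∂_{y_d}g(y)| + c √T · sup|f|. -/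
noncomputable section

open Real Set Matrix

/-- `Sig C t s = ∫_t^s C(u) C(u)ᵀ du` (entrywise Bochner integral). -/
noncomputable def Sig {D : ℕ} (C : ℝ → Matrix (Fin D) (Fin D) ℝ) (t s : ℝ) :
    Matrix (Fin D) (Fin D) ℝ :=
  fun i j => ∫ u in t..s, (C u * (C u)ᵀ) i j

/-- Uniform ellipticity: `δ |y|² ≤ yᵀ C(t)C(t)ᵀ y ≤ δ' |y|²` for all `t ∈ [0,1]`. -/
def Ellip (D : ℕ) (δ δ' : ℝ) (C : ℝ → Matrix (Fin D) (Fin D) ℝ) : Prop :=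
  ∀ t ∈ Set.Icc (0:ℝ) 1, ∀ y : Fin D → ℝ,
    δ * (∑ i, y i ^ 2) ≤ (∑ i, ∑ j, y i * (C t * (C t)ᵀ) i j * y j) ∧
    (∑ i, ∑ j, y i * (C t * (C t)ᵀ) i j * y j) ≤ δ' * (∑ i, y i ^ 2)

/-- Euclidean norm on `ℝ^D`. -/
noncomputable def en {D : ℕ} (x : Fin D → ℝ) : ℝ := Real.sqrt (∑ i, x i ^ 2)

/-- The Gaussian kernel `Γ(t,s,y)`. -/
noncomputable def Gam {D : ℕ} (C : ℝ → Matrix (Fin D) (Fin D) ℝ) (t s : ℝ)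
    (y : Fin D → ℝ) : ℝ :=
  Real.exp (-(1/2) * ∑ i, ∑ j, y i * (Sig C t s)⁻¹ i j * y j) /
    ((2 * Real.pi) ^ ((D : ℝ) / 2) * Real.sqrt (Sig C t s).det)

open MeasureTheory Filter Topology

/-- The standard Gaussian density on `ℝ^D`. -/
def stdGauss {D : ℕ} (z : Fin D → ℝ) : ℝ :=
  Real.exp (-(1/2) * (z ⬝ᵥ z)) / (2 * Real.pi) ^ ((D : ℝ) / 2)

section StandardGaussian

variable {D : ℕ}

theorem dotProduct_self_real_nonneg (z : Fin D → ℝ) : 0 ≤ z ⬝ᵥ z :=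
  Finset.sum_nonneg fun i _ => mul_self_nonneg (z i)

theorem dotProduct_sq_le (u w : Fin D → ℝ) : (u ⬝ᵥ w) ^ 2 ≤ (u ⬝ᵥ u) * (w ⬝ᵥ w) := by
  simpa [dotProduct, sq] using Finset.sum_mul_sq_le_sq_mul_sq Finset.univ u w

theorem abs_dotProduct_le (u w : Fin D → ℝ) : |u ⬝ᵥ w| ≤ √(u ⬝ᵥ u) * √(w ⬝ᵥ w) := by
  rw [← Real.sqrt_mul (dotProduct_self_real_nonneg u)]
  exact Real.abs_le_sqrt (dotProduct_sq_le u w)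

theorem norm_le_sqrt_dotProduct (z : Fin D → ℝ) : ‖z‖ ≤ √(z ⬝ᵥ z) := by
  refine (pi_norm_le_iff_of_nonneg (Real.sqrt_nonneg _)).2 fun i => ?_
  refine Real.abs_le_sqrt ?_
  rw [sq]
  exact Finset.single_le_sum (f := fun i => z i * z i) (fun j _ => mul_self_nonneg _)
    (Finset.mem_univ i)

theorem exp_neg_mul_dotProduct (b : ℝ) (z : Fin D → ℝ) :
    Real.exp (-b * (z ⬝ᵥ z)) = ∏ i, Real.exp (-b * z i ^ 2) := by
  rw [← Real.exp_sum, dotProduct, Finset.mul_sum]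
  simp [sq]

theorem integrable_exp_neg_mul_dotProduct {b : ℝ} (hb : 0 < b) :
    Integrable fun z : Fin D → ℝ => Real.exp (-b * (z ⬝ᵥ z)) := by
  simp_rw [exp_neg_mul_dotProduct]
  exact Integrable.fintype_prod fun _ => integrable_exp_neg_mul_sq hb

theorem continuous_stdGauss : Continuous (stdGauss (D := D)) := by
  unfold stdGauss dotProduct
  fun_prop

theorem stdGauss_nonneg (z : Fin D → ℝ) : 0 ≤ stdGauss z := by
  unfold stdGauss
  positivity

theorem integrable_stdGauss : Integrable (stdGauss (D := D)) :=
  (integrable_exp_neg_mul_dotProduct (by norm_num : (0:ℝ) < 1 / 2)).div_const _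

theorem integral_stdGauss : ∫ z : Fin D → ℝ, stdGauss z = 1 := by
  unfold stdGauss
  rw [integral_div]
  simp_rw [exp_neg_mul_dotProduct]
  rw [integral_fintype_prod_volume_eq_pow fun x : ℝ => Real.exp (-(1/2) * x ^ 2),
    integral_gaussian, Fintype.card_fin, show π / (1 / 2) = 2 * π by ring,
    Real.sqrt_eq_rpow, ← Real.rpow_natCast, ← Real.rpow_mul (by positivity),
    show (1 / 2 : ℝ) * D = D / 2 by ring]
  exact div_self (by positivity)

theorem sqrt_le_exp_div_four {r : ℝ} (hr : 0 ≤ r) : √r ≤ Real.exp (r / 4) := by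
  have h := Real.add_one_le_exp (r / 4)
  have h2 := Real.sq_sqrt hr
  nlinarith [sq_nonneg (√r / 2 - 1)]

theorem sqrt_mul_stdGauss_le (z : Fin D → ℝ) :
    √(z ⬝ᵥ z) * stdGauss z ≤
      Real.exp (-(1/4) * (z ⬝ᵥ z)) / (2 * Real.pi) ^ ((D : ℝ) / 2) := by
  unfold stdGauss
  rw [← mul_div_assoc]
  gcongr
  calc _ ≤ Real.exp ((z ⬝ᵥ z) / 4) * Real.exp (-(1/2) * (z ⬝ᵥ z)) := by
        gcongr
        exact sqrt_le_exp_div_four (dotProduct_self_real_nonneg z)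
    _ = _ := by rw [← Real.exp_add]; ring_nf

theorem integrable_sqrt_mul_stdGauss :
    Integrable fun z : Fin D → ℝ => √(z ⬝ᵥ z) * stdGauss z := by
  refine ((integrable_exp_neg_mul_dotProduct (by norm_num : (0:ℝ) < 1 / 4)).div_const
    ((2 * Real.pi) ^ ((D : ℝ) / 2))).mono' ?_ ?_
  · have : Continuous fun z : Fin D → ℝ => z ⬝ᵥ z := by unfold dotProduct; fun_prop
    exact (this.sqrt.mul continuous_stdGauss).aestronglyMeasurable
  · refine Eventually.of_forall fun z => ?_
    rw [Real.norm_of_nonneg (mul_nonneg (Real.sqrt_nonneg _) (stdGauss_nonneg z))]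
    exact sqrt_mul_stdGauss_le z

theorem hasDerivAt_stdGauss_sub (z w : Fin D → ℝ) (h : ℝ) :
    HasDerivAt (fun h : ℝ => stdGauss (z - h • w))
      (stdGauss (z - h • w) * ((z - h • w) ⬝ᵥ w)) h := by
  have e : (fun h : ℝ => stdGauss (z - h • w)) = fun h : ℝ =>
      Real.exp (-(1/2) * (z ⬝ᵥ z - 2 * h * (z ⬝ᵥ w) + h ^ 2 * (w ⬝ᵥ w))) /
        (2 * Real.pi) ^ ((D : ℝ) / 2) := by
    funext h
    unfold stdGauss
    congr 3
    simp only [sub_dotProduct, dotProduct_sub, smul_dotProduct, dotProduct_smul, smul_eq_mul,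
      dotProduct_comm w z]
    ring
  have h1 : HasDerivAt
      (fun h : ℝ => -(1/2) * (z ⬝ᵥ z - 2 * h * (z ⬝ᵥ w) + h ^ 2 * (w ⬝ᵥ w)))
      ((z - h • w) ⬝ᵥ w) h := by
    have := ((((hasDerivAt_id h).const_mul 2).mul_const (z ⬝ᵥ w)).const_sub (z ⬝ᵥ z)
      |>.add (((hasDerivAt_id h).pow 2).mul_const (w ⬝ᵥ w))).const_mul (-(1/2) : ℝ)
    refine this.congr_deriv ?_
    simp only [sub_dotProduct, smul_dotProduct, smul_eq_mul, id]
    push_cast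
    ring
  have h2 := (h1.exp).div_const ((2 * Real.pi) ^ ((D : ℝ) / 2))
  rw [e]
  refine h2.congr_deriv ?_
  rw [show stdGauss (z - h • w) = _ from congrFun e h]
  ring

theorem integrable_stdGauss_mul_bounded {k : (Fin D → ℝ) → ℝ} (hk : Continuous k) {M : ℝ}
    (hM : ∀ z, |k z| ≤ M) (w : Fin D → ℝ) :
    Integrable fun z => stdGauss (z - w) * k z :=
  (integrable_stdGauss.comp_sub_right w).mul_bdd hk.aestronglyMeasurable
    (Eventually.of_forall hM)

theorem abs_integral_stdGauss_mul_le {k : (Fin D → ℝ) → ℝ} {M : ℝ}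
    (hM : ∀ z, |k z| ≤ M) : |∫ z, stdGauss z * k z| ≤ M := by
  calc |∫ z, stdGauss z * k z| ≤ ∫ z : Fin D → ℝ, stdGauss z * M := by
        rw [← Real.norm_eq_abs]
        refine norm_integral_le_of_norm_le (integrable_stdGauss.mul_const M)
          (Eventually.of_forall fun z => ?_)
        rw [norm_mul, Real.norm_of_nonneg (stdGauss_nonneg z)]
        exact mul_le_mul_of_nonneg_left (hM z) (stdGauss_nonneg z)
    _ = M := by rw [integral_mul_const, integral_stdGauss, one_mul]

/-- Differentiating a translate of the Gaussian density under the integral sign. -/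
theorem exists_hasDerivAt_integral_stdGauss_sub {k : (Fin D → ℝ) → ℝ} (hk : Continuous k) {M : ℝ}
    (hM : ∀ z, |k z| ≤ M) (w : Fin D → ℝ) :
    ∃ d, HasDerivAt (fun h : ℝ => ∫ z, stdGauss (z - h • w) * k z) d 0 ∧
      |d| ≤ (∫ z : Fin D → ℝ, √(z ⬝ᵥ z) * stdGauss z) * √(w ⬝ᵥ w) * M := by
  have hM0 : 0 ≤ M := (abs_nonneg _).trans (hM 0)
  have hdot : Continuous fun z : Fin D → ℝ => z ⬝ᵥ w := by unfold dotProduct; fun_prop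
  set c := Real.exp ((1/4) * (w ⬝ᵥ w)) / (2 * Real.pi) ^ ((D : ℝ) / 2) * √(w ⬝ᵥ w) * M
  have hbound : ∀ z : Fin D → ℝ, ∀ h ∈ Metric.ball (0:ℝ) 1,
      ‖stdGauss (z - h • w) * ((z - h • w) ⬝ᵥ w) * k z‖ ≤ Real.exp (-(1/8) * (z ⬝ᵥ z)) * c := by
    intro z h hh
    set u := z - h • w with hu
    rw [norm_mul, norm_mul, Real.norm_of_nonneg (stdGauss_nonneg u), Real.norm_eq_abs,
      Real.norm_eq_abs]
    have hh1 : h ^ 2 ≤ 1 := by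
      rw [mem_ball_zero_iff, Real.norm_eq_abs] at hh
      rw [← sq_abs]
      nlinarith [abs_nonneg h]
    have hzu : -(1/4) * (u ⬝ᵥ u) ≤ -(1/8) * (z ⬝ᵥ z) + (1/4) * (w ⬝ᵥ w) := by
      have h0 := dotProduct_self_real_nonneg (z - (2 * h) • w)
      have hw := dotProduct_self_real_nonneg w
      simp only [hu, sub_dotProduct, dotProduct_sub, smul_dotProduct, dotProduct_smul, smul_eq_mul,
        dotProduct_comm w z] at h0 ⊢
      nlinarith [mul_le_mul_of_nonneg_right hh1 hw]
    calc stdGauss u * |u ⬝ᵥ w| * |k z|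
        ≤ stdGauss u * (√(u ⬝ᵥ u) * √(w ⬝ᵥ w)) * M := by
          gcongr
          · exact mul_nonneg (stdGauss_nonneg u) (by positivity)
          · exact stdGauss_nonneg u
          · exact abs_dotProduct_le u w
          · exact hM z
      _ = (√(u ⬝ᵥ u) * stdGauss u) * (√(w ⬝ᵥ w) * M) := by ring
      _ ≤ (Real.exp (-(1/4) * (u ⬝ᵥ u)) / (2 * Real.pi) ^ ((D : ℝ) / 2)) * (√(w ⬝ᵥ w) * M) := by
          gcongr
          exact sqrt_mul_stdGauss_le u
      _ ≤ (Real.exp (-(1/8) * (z ⬝ᵥ z) + (1/4) * (w ⬝ᵥ w)) /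
            (2 * Real.pi) ^ ((D : ℝ) / 2)) * (√(w ⬝ᵥ w) * M) := by
          gcongr
      _ = _ := by rw [Real.exp_add]; ring
  have hmeas : ∀ h : ℝ, AEStronglyMeasurable (fun z => stdGauss (z - h • w) * k z) volume :=
    fun h => ((continuous_stdGauss.comp (by fun_prop)).mul hk).aestronglyMeasurable
  have hmeas' : AEStronglyMeasurable
      (fun z => stdGauss (z - (0:ℝ) • w) * ((z - (0:ℝ) • w) ⬝ᵥ w) * k z) volume :=
    (((continuous_stdGauss.comp (by fun_prop)).mul
      (hdot.comp (by fun_prop))).mul hk).aestronglyMeasurable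
  have hbi : Integrable fun z : Fin D → ℝ => Real.exp (-(1/8) * (z ⬝ᵥ z)) * c :=
    (integrable_exp_neg_mul_dotProduct (by norm_num)).mul_const _
  have key := hasDerivAt_integral_of_dominated_loc_of_deriv_le
    (Metric.ball_mem_nhds (0:ℝ) one_pos) (Eventually.of_forall hmeas)
    (integrable_stdGauss_mul_bounded hk hM _) hmeas' (Eventually.of_forall hbound) hbi
    (Eventually.of_forall fun z h _ => (hasDerivAt_stdGauss_sub z w h).mul_const (k z))
  refine ⟨_, key.2, ?_⟩
  simp only [zero_smul, sub_zero]
  rw [← integral_mul_const, ← integral_mul_const, ← Real.norm_eq_abs]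
  refine norm_integral_le_of_norm_le ((integrable_sqrt_mul_stdGauss.mul_const _).mul_const _)
    (Eventually.of_forall fun z => ?_)
  rw [norm_mul, norm_mul, Real.norm_of_nonneg (stdGauss_nonneg z), Real.norm_eq_abs,
    Real.norm_eq_abs]
  calc _ ≤ stdGauss z * (√(z ⬝ᵥ z) * √(w ⬝ᵥ w)) * M := by
        gcongr
        · exact mul_nonneg (stdGauss_nonneg z) (by positivity)
        · exact stdGauss_nonneg z
        · exact abs_dotProduct_le z w
        · exact hM z
    _ = _ := by ring

/-- Differentiating a Gaussian average of a `C¹` function with bounded gradient. -/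
theorem exists_hasDerivAt_integral_stdGauss_mul_comp {g : (Fin D → ℝ) → ℝ} (hg : ContDiff ℝ 1 g)
    {M : ℝ} (hM : ∀ x, ‖fderiv ℝ g x‖ ≤ M) (A : Matrix (Fin D) (Fin D) ℝ) (y e : Fin D → ℝ)
    {L : ℝ} (hL : ∀ x, |fderiv ℝ g x e| ≤ L) :
    ∃ d, HasDerivAt (fun h : ℝ => ∫ z, stdGauss z * g (y + h • e + A *ᵥ z)) d 0 ∧ |d| ≤ L := by
  have hAc : Continuous fun z : Fin D → ℝ => A *ᵥ z := by fun_prop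
  have hM0 : 0 ≤ M := (norm_nonneg _).trans (hM 0)
  have hcont : ∀ h : ℝ, Continuous fun z : Fin D → ℝ => stdGauss z * g (y + h • e + A *ᵥ z) :=
    fun h => continuous_stdGauss.mul (hg.continuous.comp (by fun_prop))
  have hF0 : Integrable fun z : Fin D → ℝ => stdGauss z * g (y + (0:ℝ) • e + A *ᵥ z) := by
    obtain ⟨K, hK⟩ : ∃ K : ℝ, 0 ≤ K ∧ ∀ z : Fin D → ℝ, ‖A *ᵥ z‖ ≤ K * ‖z‖ :=
      ⟨‖LinearMap.toContinuousLinearMap (toLin' A)‖, norm_nonneg _, fun z =>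
        (LinearMap.toContinuousLinearMap (toLin' A)).le_opNorm z⟩
    refine ((integrable_stdGauss.const_mul |g y|).add
      (integrable_sqrt_mul_stdGauss.const_mul (M * K))).mono' (hcont 0).aestronglyMeasurable
      (Eventually.of_forall fun z => ?_)
    have hlip := (convex_univ (𝕜 := ℝ) (E := Fin D → ℝ)).norm_image_sub_le_of_norm_fderiv_le
      (f := g) (𝕜 := ℝ) (C := M) (fun x _ => hg.differentiable one_ne_zero x) (fun x _ => hM x)
      (mem_univ y) (mem_univ (y + A *ᵥ z))
    rw [add_sub_cancel_left] at hlip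
    have h1 : |g (y + A *ᵥ z)| ≤ |g y| + M * K * √(z ⬝ᵥ z) := by
      calc |g (y + A *ᵥ z)| ≤ |g y| + |g (y + A *ᵥ z) - g y| := by
            simpa using abs_add_le (g y) (g (y + A *ᵥ z) - g y)
        _ ≤ |g y| + M * (K * √(z ⬝ᵥ z)) := by
            gcongr
            refine hlip.trans ?_
            gcongr
            exact (hK.2 z).trans (mul_le_mul_of_nonneg_left (norm_le_sqrt_dotProduct z) hK.1)
        _ = _ := by ring
    simp only [zero_smul, add_zero, norm_mul, Real.norm_of_nonneg (stdGauss_nonneg z),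
      Real.norm_eq_abs, Pi.add_apply]
    calc _ ≤ stdGauss z * (|g y| + M * K * √(z ⬝ᵥ z)) :=
          mul_le_mul_of_nonneg_left h1 (stdGauss_nonneg z)
      _ = _ := by ring
  have hder : ∀ (z : Fin D → ℝ) (h : ℝ),
      HasDerivAt (fun h : ℝ => stdGauss z * g (y + h • e + A *ᵥ z))
        (stdGauss z * fderiv ℝ g (y + h • e + A *ᵥ z) e) h := fun z h => by
    refine HasDerivAt.const_mul _ ?_
    have h1 : HasDerivAt (fun h : ℝ => y + h • e + A *ᵥ z) e h := by
      simpa using (((hasDerivAt_id h).smul_const e).const_add y).add_const (A *ᵥ z)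
    exact ((hg.differentiable one_ne_zero _).hasFDerivAt).comp_hasDerivAt h h1
  have hfd : Continuous fun x => fderiv ℝ g x e :=
    (hg.continuous_fderiv one_ne_zero).clm_apply continuous_const
  have key := hasDerivAt_integral_of_dominated_loc_of_deriv_le (μ := volume) (x₀ := (0:ℝ))
    (F := fun h z => stdGauss z * g (y + h • e + A *ᵥ z))
    (F' := fun h z => stdGauss z * fderiv ℝ g (y + h • e + A *ᵥ z) e)
    (s := univ) (bound := fun z => stdGauss z * L) univ_mem
    (Eventually.of_forall fun h => (hcont h).aestronglyMeasurable) hF0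
    (continuous_stdGauss.mul (hfd.comp (by fun_prop))).aestronglyMeasurable
    (Eventually.of_forall fun z h _ => by
      rw [norm_mul, Real.norm_of_nonneg (stdGauss_nonneg z)]
      exact mul_le_mul_of_nonneg_left (hL _) (stdGauss_nonneg z))
    (integrable_stdGauss.mul_const L) (Eventually.of_forall fun z h _ => hder z h)
  exact ⟨_, key.2, abs_integral_stdGauss_mul_le fun z => hL _⟩

end StandardGaussian

section EllipticKernel

variable {D : ℕ} {C : ℝ → Matrix (Fin D) (Fin D) ℝ}

theorem sum_sum_eq_dotProduct_mulVec (M : Matrix (Fin D) (Fin D) ℝ) (y : Fin D → ℝ) :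
    ∑ i, ∑ j, y i * M i j * y j = y ⬝ᵥ M *ᵥ y := by
  simp [dotProduct, mulVec, Finset.mul_sum, mul_assoc]

theorem continuous_mul_transpose_apply (hC : Continuous C) (i j : Fin D) :
    Continuous fun u => (C u * (C u)ᵀ) i j :=
  (hC.matrix_mul hC.matrix_transpose).matrix_elem i j

theorem continuous_Sig (hC : Continuous C) (t : ℝ) : Continuous fun s => Sig C t s :=
  continuous_matrix fun i j => intervalIntegral.continuous_primitive
    (fun _ _ => (continuous_mul_transpose_apply hC i j).intervalIntegrable _ _) t

theorem transpose_Sig (C : ℝ → Matrix (Fin D) (Fin D) ℝ) (t s : ℝ) :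
    (Sig C t s)ᵀ = Sig C t s := by
  ext i j
  refine intervalIntegral.integral_congr fun u _ => ?_
  simp [Matrix.mul_apply, mul_comm]

theorem le_dotProduct_Sig_mulVec {δ δ' : ℝ} (hC : Continuous C) (hE : Ellip D δ δ' C) {t s : ℝ}
    (ht : 0 ≤ t) (hts : t ≤ s) (hs : s ≤ 1) (y : Fin D → ℝ) :
    δ * (s - t) * (y ⬝ᵥ y) ≤ y ⬝ᵥ Sig C t s *ᵥ y := by
  have hcont := continuous_mul_transpose_apply hC
  have e : y ⬝ᵥ Sig C t s *ᵥ y =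
      ∫ u in t..s, ∑ i, ∑ j, y i * (C u * (C u)ᵀ) i j * y j := by
    rw [← sum_sum_eq_dotProduct_mulVec, intervalIntegral.integral_finsetSum]
    · refine Finset.sum_congr rfl fun i _ => ?_
      rw [intervalIntegral.integral_finsetSum]
      · refine Finset.sum_congr rfl fun j _ => ?_
        rw [intervalIntegral.integral_mul_const, intervalIntegral.integral_const_mul]
        rfl
      · intro j _
        exact ((continuous_const.mul (hcont i j)).mul continuous_const).intervalIntegrable _ _
    · intro i _
      exact (continuous_finsetSum _ fun j _ =>
        (continuous_const.mul (hcont i j)).mul continuous_const).intervalIntegrable _ _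
  have hq : Continuous fun u => ∑ i, ∑ j, y i * (C u * (C u)ᵀ) i j * y j :=
    continuous_finsetSum _ fun i _ => continuous_finsetSum _ fun j _ =>
      (continuous_const.mul (hcont i j)).mul continuous_const
  have h0 : δ * (s - t) * (y ⬝ᵥ y) = ∫ _ in t..s, δ * (y ⬝ᵥ y) := by
    rw [intervalIntegral.integral_const, smul_eq_mul]
    ring
  rw [e, h0]
  refine intervalIntegral.integral_mono_on hts (by simp) (hq.intervalIntegrable _ _) fun u hu => ?_
  have := (hE u ⟨ht.trans hu.1, hu.2.trans hs⟩ y).1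
  simpa [dotProduct, sq] using this

open scoped MatrixOrder in
/-- A factorization `Σ(t,s) = A Aᵀ` with `A` invertible. -/
theorem exists_Sig_eq_mul_transpose {δ δ' : ℝ} (hδ : 0 < δ) (hC : Continuous C)
    (hE : Ellip D δ δ' C) {t s : ℝ} (ht : 0 ≤ t) (hts : t < s) (hs : s ≤ 1) :
    ∃ A : Matrix (Fin D) (Fin D) ℝ, Sig C t s = A * Aᵀ ∧ A.det ≠ 0 := by
  have hpd : (Sig C t s).PosDef := by
    refine .of_dotProduct_mulVec_pos ?_ fun x hx => ?_
    · rw [IsHermitian, conjTranspose_eq_transpose_of_trivial, transpose_Sig]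
    · have hxx : 0 < x ⬝ᵥ x :=
        (dotProduct_self_real_nonneg x).lt_of_ne' fun h => hx (dotProduct_self_eq_zero.1 h)
      have h := le_dotProduct_Sig_mulVec hC hE ht hts.le hs x
      rw [star_trivial]
      exact (mul_pos (mul_pos hδ (sub_pos.2 hts)) hxx).trans_le h
  obtain ⟨B, hB⟩ := CStarAlgebra.nonneg_iff_eq_star_mul_self.mp hpd.posSemidef.nonneg
  refine ⟨Bᵀ, by simpa [star_eq_conjTranspose] using hB, fun h => ?_⟩
  have := hpd.det_pos
  rw [hB, det_mul, ← det_transpose B, h, mul_zero] at this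
  exact this.false

theorem Gam_mulVec {t s : ℝ} {A : Matrix (Fin D) (Fin D) ℝ} (hA : Sig C t s = A * Aᵀ)
    (hdet : A.det ≠ 0) (z : Fin D → ℝ) :
    Gam C t s (A *ᵥ z) = |A.det|⁻¹ * stdGauss z := by
  have hu : IsUnit A.det := isUnit_iff_ne_zero.2 hdet
  unfold Gam stdGauss
  rw [sum_sum_eq_dotProduct_mulVec, hA, Matrix.mul_inv_rev, ← mulVec_mulVec, mulVec_mulVec z A⁻¹ A,
    nonsing_inv_mul A hu, one_mulVec, dotProduct_mulVec, ← transpose_nonsing_inv,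
    vecMul_transpose, mulVec_mulVec, nonsing_inv_mul A hu, one_mulVec, det_mul, det_transpose,
    Real.sqrt_mul_self_eq_abs]
  field_simp

theorem integral_comp_mulVec {A : Matrix (Fin D) (Fin D) ℝ} (hdet : A.det ≠ 0)
    (G : (Fin D → ℝ) → ℝ) : ∫ z, G (A *ᵥ z) = |A.det|⁻¹ * ∫ v, G v := by
  have hu : IsUnit A.det := isUnit_iff_ne_zero.2 hdet
  have hemb : MeasurableEmbedding (toLin' A) := by
    let e : (Fin D → ℝ) ≃ₜ (Fin D → ℝ) :=
      { toFun := fun z => A *ᵥ z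
        invFun := fun z => A⁻¹ *ᵥ z
        left_inv := fun z => by simp [mulVec_mulVec, nonsing_inv_mul A hu]
        right_inv := fun z => by simp [mulVec_mulVec, mul_nonsing_inv A hu]
        continuous_toFun := by fun_prop
        continuous_invFun := by fun_prop }
    exact e.measurableEmbedding
  have h := hemb.integral_map (μ := volume) G
  rw [Real.map_matrix_volume_pi_eq_smul_volume_pi hdet, integral_smul_measure,
    ENNReal.toReal_ofReal (abs_nonneg _), abs_inv, smul_eq_mul] at h
  exact h.symm

/-- Change of variables `x = y + A z` in an integral against the kernel. -/
theorem integral_Gam_mul {t s : ℝ} {A : Matrix (Fin D) (Fin D) ℝ} (hA : Sig C t s = A * Aᵀ)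
    (hdet : A.det ≠ 0) (y : Fin D → ℝ) (F : (Fin D → ℝ) → ℝ) :
    ∫ x, Gam C t s (x - y) * F x = ∫ z, stdGauss z * F (y + A *ᵥ z) := by
  have h := integral_comp_mulVec hdet fun v => Gam C t s v * F (y + v)
  simp_rw [Gam_mulVec hA hdet, mul_assoc] at h
  rw [integral_const_mul] at h
  rw [mul_left_cancel₀ (by simpa using hdet) h,
    ← integral_sub_right_eq_self (fun v => Gam C t s v * F (y + v)) y]
  simp

theorem dotProduct_nonsing_inv_mulVec_le {t s κ : ℝ} (hκ : 0 < κ)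
    {A : Matrix (Fin D) (Fin D) ℝ} (hA : Sig C t s = A * Aᵀ) (hdet : A.det ≠ 0)
    (hq : ∀ y : Fin D → ℝ, κ * (y ⬝ᵥ y) ≤ y ⬝ᵥ Sig C t s *ᵥ y) (e : Fin D → ℝ) :
    (A⁻¹ *ᵥ e) ⬝ᵥ (A⁻¹ *ᵥ e) ≤ (e ⬝ᵥ e) / κ := by
  have hu : IsUnit A.det := isUnit_iff_ne_zero.2 hdet
  have hut : IsUnit (Aᵀ).det := by rwa [det_transpose]
  set w := A⁻¹ *ᵥ e with hw
  set v := (Aᵀ)⁻¹ *ᵥ w with hv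
  have hAw : A *ᵥ w = e := by rw [hw, mulVec_mulVec, mul_nonsing_inv A hu, one_mulVec]
  have hAv : Aᵀ *ᵥ v = w := by rw [hv, mulVec_mulVec, mul_nonsing_inv _ hut, one_mulVec]
  have h1 : v ⬝ᵥ Sig C t s *ᵥ v = w ⬝ᵥ w := by
    rw [hA, ← mulVec_mulVec, hAv, dotProduct_mulVec, ← mulVec_transpose, hAv]
  have h2 : w ⬝ᵥ w = v ⬝ᵥ e := by
    nth_rewrite 1 [← hAv]
    rw [mulVec_transpose, ← dotProduct_mulVec, hAw]
  have h3 := hq v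
  have h4 := dotProduct_sq_le v e
  have hww := dotProduct_self_real_nonneg w
  have hee := dotProduct_self_real_nonneg e
  rw [h1] at h3
  rw [← h2] at h4
  rw [le_div_iff₀ hκ]
  rcases hww.eq_or_lt with h | h
  · rw [← h, zero_mul]
    exact hee
  · refine le_of_mul_le_mul_left ?_ h
    nlinarith [mul_le_mul_of_nonneg_right h3 hee, mul_le_mul_of_nonneg_left h4 hκ.le]

/-- Line derivative of a bounded function smoothed by the kernel. -/
theorem exists_hasLineDerivAt_integral_Gam_mul {t s κ : ℝ} (hκ : 0 < κ)
    {A : Matrix (Fin D) (Fin D) ℝ} (hA : Sig C t s = A * Aᵀ) (hdet : A.det ≠ 0)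
    (hq : ∀ y : Fin D → ℝ, κ * (y ⬝ᵥ y) ≤ y ⬝ᵥ Sig C t s *ᵥ y)
    {k : (Fin D → ℝ) → ℝ} (hk : Continuous k) {M : ℝ} (hM : ∀ z, |k z| ≤ M)
    (y e : Fin D → ℝ) :
    ∃ d, HasLineDerivAt ℝ (fun y' => ∫ x, Gam C t s (x - y') * k x) d y e ∧
      |d| ≤ (∫ z : Fin D → ℝ, √(z ⬝ᵥ z) * stdGauss z) * √((e ⬝ᵥ e) / κ) * M := by
  have hM0 : 0 ≤ M := (abs_nonneg _).trans (hM 0)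
  have hu : IsUnit A.det := isUnit_iff_ne_zero.2 hdet
  obtain ⟨d, hd, hb⟩ := exists_hasDerivAt_integral_stdGauss_sub
    (k := fun z => k (y + A *ᵥ z)) (hk.comp (by fun_prop)) (fun z => hM _) (A⁻¹ *ᵥ e)
  refine ⟨d, ?_, hb.trans ?_⟩
  · unfold HasLineDerivAt
    refine hd.congr_of_eventuallyEq (Eventually.of_forall fun h => ?_)
    simp only
    rw [integral_Gam_mul hA hdet,
      ← integral_sub_right_eq_self _ (h • A⁻¹ *ᵥ e)]
    congr 1
    funext z
    rw [mulVec_sub, mulVec_smul, mulVec_mulVec, mul_nonsing_inv A hu, one_mulVec]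
    congr 2
    abel
  · have : 0 ≤ ∫ z : Fin D → ℝ, √(z ⬝ᵥ z) * stdGauss z :=
      integral_nonneg fun z => mul_nonneg (Real.sqrt_nonneg _) (stdGauss_nonneg z)
    gcongr
    exact dotProduct_nonsing_inv_mulVec_le hκ hA hdet hq e

theorem measurable_Gam (hC : Continuous C) (t : ℝ) :
    Measurable fun p : ℝ × (Fin D → ℝ) => Gam C t p.1 p.2 := by
  have hS := continuous_Sig hC t
  have hdet : Measurable fun s => (Sig C t s).det := hS.matrix_det.measurable
  have hinv : ∀ i j, Measurable fun s => (Sig C t s)⁻¹ i j := fun i j => by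
    simp_rw [Matrix.inv_def, Matrix.smul_apply, Ring.inverse_eq_inv', smul_eq_mul]
    exact hdet.inv.mul (hS.matrix_adjugate.matrix_elem i j).measurable
  unfold Gam
  refine (Real.measurable_exp.comp (measurable_const.mul ?_)).div
    (measurable_const.mul (hdet.comp measurable_fst).sqrt)
  refine Finset.measurable_sum _ fun i _ => Finset.measurable_sum _ fun j _ => ?_
  exact (((measurable_pi_apply i).comp measurable_snd).mul ((hinv i j).comp measurable_fst)).mul
    ((measurable_pi_apply j).comp measurable_snd)

theorem stronglyMeasurable_integral_sub_mul {G f : ℝ → (Fin D → ℝ) → ℝ}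
    (hG : Measurable fun p : ℝ × (Fin D → ℝ) => G p.1 p.2)
    (hf : Measurable fun p : ℝ × (Fin D → ℝ) => f p.1 p.2)
    (y : Fin D → ℝ) : StronglyMeasurable fun s => ∫ x, G s (x - y) * f s x := by
  have hm : Measurable fun p : ℝ × (Fin D → ℝ) => (p.1, p.2 - y) :=
    measurable_fst.prodMk (measurable_snd.sub_const y)
  exact ((hG.comp hm).mul hf).stronglyMeasurable.integral_prod_right'

end EllipticKernel

section SmoothedSource

variable {D : ℕ} {C : ℝ → Matrix (Fin D) (Fin D) ℝ}

theorem integral_sub_rpow_neg_half (t T : ℝ) :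
    ∫ s in t..T, (s - t) ^ (-(1/2) : ℝ) = 2 * √(T - t) := by
  rw [intervalIntegral.integral_comp_sub_right (fun u : ℝ => u ^ (-(1/2) : ℝ)) t,
    integral_rpow (Or.inl (by norm_num)), sub_self, Real.sqrt_eq_rpow]
  norm_num
  ring

theorem intervalIntegrable_sub_rpow_neg_half (t T : ℝ) :
    IntervalIntegrable (fun s : ℝ => (s - t) ^ (-(1/2) : ℝ)) volume t T := by
  have h := (intervalIntegral.intervalIntegrable_rpow' (a := 0) (b := T - t)
    (by norm_num : (-1 : ℝ) < -(1/2))).comp_sub_right t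
  simpa using h

/-- Line derivative of the source term `∫_t^T ∫ Γ(t,s,x-y) f(s,x) dx ds`. -/
theorem exists_hasLineDerivAt_integral_integral_Gam_mul {δ δ' : ℝ} (hδ : 0 < δ)
    (hC : Continuous C) (hE : Ellip D δ δ' C) {t T : ℝ} (ht : 0 ≤ t) (htT : t ≤ T) (hT : T ≤ 1)
    {f : ℝ → (Fin D → ℝ) → ℝ} (hf : Continuous fun p : ℝ × (Fin D → ℝ) => f p.1 p.2)
    {M : ℝ} (hM : ∀ s x, |f s x| ≤ M) (y e : Fin D → ℝ) :
    ∃ d, HasLineDerivAt ℝ (fun y' => ∫ s in t..T, ∫ x, Gam C t s (x - y') * f s x) d y e ∧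
      |d| ≤ (∫ z : Fin D → ℝ, √(z ⬝ᵥ z) * stdGauss z) * √((e ⬝ᵥ e) / δ) * M *
        (2 * √(T - t)) := by
  set K := (∫ z : Fin D → ℝ, √(z ⬝ᵥ z) * stdGauss z) * √((e ⬝ᵥ e) / δ) * M with hK
  set φ : ℝ → (Fin D → ℝ) → ℝ := fun s y' => ∫ x, Gam C t s (x - y') * f s x with hφ
  have hfs : ∀ s, Continuous (f s) := fun s => hf.comp (by fun_prop : Continuous fun x => (s, x))
  have hder : ∀ s ∈ Ioc t T, ∀ y',
      HasLineDerivAt ℝ (φ s) (lineDeriv ℝ (φ s) y' e) y' e ∧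
        |lineDeriv ℝ (φ s) y' e| ≤ K * (s - t) ^ (-(1/2) : ℝ) := by
    intro s hs y'
    have hst : 0 < s - t := sub_pos.2 hs.1
    obtain ⟨A, hA, hdet⟩ := exists_Sig_eq_mul_transpose hδ hC hE ht hs.1 (hs.2.trans hT)
    obtain ⟨d, hd, hb⟩ := exists_hasLineDerivAt_integral_Gam_mul (mul_pos hδ hst) hA hdet
      (le_dotProduct_Sig_mulVec hC hE ht hs.1.le (hs.2.trans hT)) (hfs s) (hM s) y' e
    rw [hd.lineDeriv]
    refine ⟨hd, hb.trans (le_of_eq ?_)⟩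
    rw [hK, ← div_div, Real.sqrt_div' _ hst.le, Real.rpow_neg hst.le, ← Real.sqrt_eq_rpow]
    ring
  have hderF : ∀ s ∈ Ioc t T, ∀ h : ℝ,
      HasDerivAt (fun h : ℝ => φ s (y + h • e)) (lineDeriv ℝ (φ s) (y + h • e) e) h := by
    intro s hs h
    have h1 : HasDerivAt (fun r : ℝ => φ s (y + h • e + r • e))
        (lineDeriv ℝ (φ s) (y + h • e) e) (h - h) := by
      rw [sub_self]
      exact (hder s hs (y + h • e)).1
    refine (h1.comp_sub_const h h).congr_of_eventuallyEq (Eventually.of_forall fun r => ?_)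
    simp only
    rw [add_assoc, ← add_smul, add_sub_cancel]
  have hmeas : ∀ y', StronglyMeasurable fun s => φ s y' := fun y' =>
    stronglyMeasurable_integral_sub_mul (measurable_Gam hC t) hf.measurable y'
  have hbd : ∀ s ∈ Ioc t T, ∀ y', ‖φ s y'‖ ≤ M := by
    intro s hs y'
    obtain ⟨A, hA, hdet⟩ := exists_Sig_eq_mul_transpose hδ hC hE ht hs.1 (hs.2.trans hT)
    simp only [hφ]
    rw [integral_Gam_mul hA hdet]
    exact abs_integral_stdGauss_mul_le fun z => hM _ _
  have hint : IntervalIntegrable (fun s => φ s (y + (0:ℝ) • e)) volume t T := by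
    rw [intervalIntegrable_iff_integrableOn_Ioc_of_le htT]
    refine Integrable.mono' (integrable_const M) (hmeas _).aestronglyMeasurable ?_
    exact (ae_restrict_iff' measurableSet_Ioc).2 (Eventually.of_forall fun s hs => hbd s hs _)
  have hmeas' : AEStronglyMeasurable (fun s => lineDeriv ℝ (φ s) (y + (0:ℝ) • e) e)
      (volume.restrict (uIoc t T)) := by
    refine aestronglyMeasurable_of_tendsto_ae (𝓝[>] (0:ℝ))
      (f := fun r s => r⁻¹ • (φ s (y + (0 + r) • e) - φ s (y + (0:ℝ) • e)))
      (fun r => (((hmeas (y + (0 + r) • e)).sub (hmeas (y + (0:ℝ) • e))).const_smul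
        r⁻¹).aestronglyMeasurable) ?_
    rw [uIoc_of_le htT]
    exact (ae_restrict_iff' measurableSet_Ioc).2
      (Eventually.of_forall fun s hs => (hderF s hs 0).tendsto_slope_zero_right)
  have hbi : IntervalIntegrable (fun s : ℝ => K * (s - t) ^ (-(1/2) : ℝ)) volume t T :=
    (intervalIntegrable_sub_rpow_neg_half t T).const_mul K
  have key := intervalIntegral.hasDerivAt_integral_of_dominated_loc_of_deriv_le
    (μ := volume) (a := t) (b := T) (x₀ := (0:ℝ)) (s := univ)
    (F := fun h s => φ s (y + h • e)) (F' := fun h s => lineDeriv ℝ (φ s) (y + h • e) e)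
    univ_mem (Eventually.of_forall fun h => (hmeas _).aestronglyMeasurable) hint hmeas'
    (Eventually.of_forall fun s hs h _ => (hder s (uIoc_of_le htT ▸ hs) _).2) hbi
    (Eventually.of_forall fun s hs h _ => hderF s (uIoc_of_le htT ▸ hs) h)
  refine ⟨_, key.2, ?_⟩
  rw [← integral_sub_rpow_neg_half t T, ← intervalIntegral.integral_const_mul, ← Real.norm_eq_abs]
  exact intervalIntegral.norm_integral_le_of_norm_le htT
    (Eventually.of_forall fun s hs => (hder s hs _).2) hbi

end SmoothedSource

theorem stmt10 (D : ℕ) (δ : ℝ) (hδ : 0 < δ) :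
    ∃ c > 0, ∀ δ' ≥ δ, ∀ C : ℝ → Matrix (Fin D) (Fin D) ℝ, Continuous C → Ellip D δ δ' C →
      ∀ T ∈ Set.Ioc (0:ℝ) 1, ∀ α ∈ Set.Ioo (0:ℝ) 1,
      ∀ g : (Fin D → ℝ) → ℝ, ContDiff ℝ 1 g → (∃ M, ∀ x, ‖fderiv ℝ g x‖ ≤ M) →
      ∀ f : ℝ → (Fin D → ℝ) → ℝ,
        (∃ M, ∀ s ∈ Set.Icc (0:ℝ) T, ∀ x, |f s x| ≤ M) →
        ContinuousOn (fun p : ℝ × (Fin D → ℝ) => f p.1 p.2) (Set.Icc 0 T ×ˢ Set.univ) →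
        (∃ K, ∀ t ∈ Set.Icc (0:ℝ) T, ∀ s ∈ Set.Icc (0:ℝ) T, ∀ x y : Fin D → ℝ,
          |f t x - f s y| ≤ K * (Real.sqrt |t - s| + en (x - y)) ^ α) →
      ∀ d : Fin D, ∀ t ∈ Set.Ico (0:ℝ) T, ∀ y : Fin D → ℝ,
        ∃ du : ℝ,
          HasLineDerivAt ℝ
            (fun y' => (∫ x : Fin D → ℝ, Gam C t T (x - y') * g x) +
              ∫ s in t..T, ∫ x : Fin D → ℝ, Gam C t s (x - y') * f s x)
            du y (Pi.single d 1) ∧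
          |du| ≤ sSup {r | ∃ x, r = |fderiv ℝ g x (Pi.single d 1)|} +
            c * Real.sqrt T * sSup {r | ∃ s x, s ∈ Set.Icc (0:ℝ) T ∧ r = |f s x|} := by
  have hI : 0 ≤ ∫ z : Fin D → ℝ, √(z ⬝ᵥ z) * stdGauss z :=
    integral_nonneg fun z => mul_nonneg (Real.sqrt_nonneg _) (stdGauss_nonneg z)
  refine ⟨2 * ((∫ z : Fin D → ℝ, √(z ⬝ᵥ z) * stdGauss z) * √(1 / δ)) + 1, by positivity, ?_⟩
  rintro δ' - C hC hE T ⟨hT0, hT1⟩ α - g hg ⟨Mg, hMg⟩ f ⟨Mf, hMf⟩ hfc - d t ⟨ht0, htT⟩ y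
  set e : Fin D → ℝ := Pi.single d 1 with he
  have hee : e ⬝ᵥ e = 1 := by simp [he]
  set L := sSup {r | ∃ x, r = |fderiv ℝ g x e|}
  set M := sSup {r | ∃ s x, s ∈ Set.Icc (0:ℝ) T ∧ r = |f s x|}
  have hgL : ∀ x, |fderiv ℝ g x e| ≤ L := fun x => by
    refine le_csSup ⟨Mg * ‖e‖, ?_⟩ ⟨x, rfl⟩
    rintro _ ⟨x, rfl⟩
    exact (fderiv ℝ g x).le_of_opNorm_le (hMg x) e
  have hfM : ∀ s ∈ Set.Icc (0:ℝ) T, ∀ x, |f s x| ≤ M := fun s hs x => by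
    refine le_csSup ⟨Mf, ?_⟩ ⟨s, x, hs, rfl⟩
    rintro _ ⟨s, x, hs, rfl⟩
    exact hMf s hs x
  have hM0 : 0 ≤ M := (abs_nonneg _).trans (hfM 0 ⟨le_rfl, hT0.le⟩ 0)
  have hproj : ∀ s, max 0 (min s T) ∈ Set.Icc (0:ℝ) T := fun s =>
    ⟨le_max_left _ _, max_le hT0.le (min_le_right _ _)⟩
  have hfc' : Continuous fun p : ℝ × (Fin D → ℝ) => f (max 0 (min p.1 T)) p.2 :=
    hfc.comp_continuous (f := fun p : ℝ × (Fin D → ℝ) => (max 0 (min p.1 T), p.2)) (by fun_prop)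
      fun p => ⟨hproj p.1, mem_univ _⟩
  obtain ⟨A, hA, hdet⟩ := exists_Sig_eq_mul_transpose hδ hC hE ht0 htT hT1
  obtain ⟨d₁, hd₁, hb₁⟩ := exists_hasDerivAt_integral_stdGauss_mul_comp hg hMg A y e hgL
  obtain ⟨d₂, hd₂, hb₂⟩ := exists_hasLineDerivAt_integral_integral_Gam_mul hδ hC hE ht0 htT.le hT1
    (f := fun s => f (max 0 (min s T))) hfc' (fun s x => hfM _ (hproj s) x) y e
  refine ⟨d₁ + d₂, ?_, (abs_add_le _ _).trans (add_le_add hb₁ (hb₂.trans ?_))⟩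
  · unfold HasLineDerivAt at hd₂ ⊢
    refine (hd₁.add hd₂).congr_of_eventuallyEq (Eventually.of_forall fun h => ?_)
    beta_reduce
    rw [integral_Gam_mul hA hdet]
    congr 1
    refine intervalIntegral.integral_congr fun s hs => ?_
    rw [uIcc_of_le htT.le] at hs
    rw [min_eq_left hs.2, max_eq_right (ht0.trans hs.1)]
  · rw [hee]
    have hTt : √(T - t) ≤ √T := Real.sqrt_le_sqrt (by linarith)
    calc _ ≤ (∫ z : Fin D → ℝ, √(z ⬝ᵥ z) * stdGauss z) * √(1 / δ) * M * (2 * √T) := by gcongr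
      _ = 2 * ((∫ z : Fin D → ℝ, √(z ⬝ᵥ z) * stdGauss z) * √(1 / δ)) * √T * M := by ring
      _ ≤ _ := by
        gcongr
        linarith
end
end

section
/- Let α ∈ (0,1), define f : ℝ → ℝ by f(x) = 2 − |x|^{1+α} for |x| ≤ 1, f(x) = (2−|x|)^{1+α} for 1 < |x| < 2, f(x) = 0 otherwise, and let F(x) := ∫_{−2}^x f(u) du for x > −2, F(x) := 0 for x ≤ −2. For T ∈ (0,1] define λ_T := ( ∫_ℝ e^{−x²/(2T)} e^{−F(−x)} f(−x) dx ) / ( ∫_ℝ e^{−x²/(2T)} e^{−F(−x)} dx ). Then λ_T ≤ 2 and 2 − λ_T ≥ e^{−4} (2πT)^{−1/2} ∫_0^1 e^{−x²/(2T)} x^{1+α} dx; moreover there exists a constant c > 0, independent of T, such that 2 − λ_T ≥ c T^{(1+α)/2} for all T ∈ (0,1]. -/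
noncomputable section

open Real Set

/-- The piecewise function `f` of the example. -/
noncomputable def exf (α : ℝ) (x : ℝ) : ℝ :=
  if |x| ≤ 1 then 2 - |x| ^ (1 + α)
  else if |x| < 2 then (2 - |x|) ^ (1 + α)
  else 0

/-- `F(x) = ∫_{-2}^x f(u) du` for `x > -2`, and `F(x) = 0` for `x ≤ -2`. -/
noncomputable def exF (α : ℝ) (x : ℝ) : ℝ :=
  if x ≤ -2 then 0 else ∫ u in (-2:ℝ)..x, exf α u

/-- `λ_T = (∫ e^{-x²/(2T)} e^{-F(-x)} f(-x) dx) / (∫ e^{-x²/(2T)} e^{-F(-x)} dx)`. -/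
noncomputable def lamT (α T : ℝ) : ℝ :=
  (∫ x : ℝ, Real.exp (-x ^ 2 / (2 * T)) * Real.exp (-exF α (-x)) * exf α (-x)) /
    (∫ x : ℝ, Real.exp (-x ^ 2 / (2 * T)) * Real.exp (-exF α (-x)))

open MeasureTheory in
lemma measurable_exf (α : ℝ) : Measurable (exf α) := by
  unfold exf
  refine Measurable.ite (measurableSet_le (by fun_prop) (by fun_prop)) (by fun_prop)
    (Measurable.ite (measurableSet_lt (by fun_prop) (by fun_prop)) (by fun_prop) (by fun_prop))

lemma exf_nonneg {α : ℝ} (hα : 0 < α) (x : ℝ) : 0 ≤ exf α x := by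
  unfold exf
  split_ifs with h1 h2
  · have := Real.rpow_le_one (abs_nonneg x) h1 (by linarith : 0 ≤ 1 + α)
    linarith
  · exact Real.rpow_nonneg (by linarith) _
  · exact le_rfl

lemma exf_le_two {α : ℝ} (hα : 0 < α) (x : ℝ) : exf α x ≤ 2 := by
  unfold exf
  split_ifs with h1 h2
  · have := Real.rpow_nonneg (abs_nonneg x) (1 + α)
    linarith
  · have := Real.rpow_le_one (by linarith : 0 ≤ 2 - |x|) (by linarith) (by linarith : 0 ≤ 1 + α)
    linarith
  · norm_num

lemma two_sub_exf_neg {α x : ℝ} (h0 : 0 ≤ x) (h1 : x ≤ 1) :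
    2 - exf α (-x) = x ^ (1 + α) := by
  simp [exf, abs_of_nonneg h0, h1]

open MeasureTheory in
lemma intervalIntegrable_exf {α : ℝ} (hα : 0 < α) (a b : ℝ) :
    IntervalIntegrable (exf α) volume a b := by
  refine (intervalIntegrable_const (c := (2 : ℝ))).mono_fun
    (measurable_exf α).aestronglyMeasurable (ae_of_all _ fun x => ?_)
  simpa [abs_of_nonneg (exf_nonneg hα x)] using exf_le_two hα x

lemma measurable_exF {α : ℝ} (hα : 0 < α) : Measurable (exF α) := by
  unfold exF
  exact Measurable.ite measurableSet_Iic measurable_const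
    (intervalIntegral.continuous_primitive (intervalIntegrable_exf hα) _).measurable

lemma exF_nonneg {α : ℝ} (hα : 0 < α) (x : ℝ) : 0 ≤ exF α x := by
  unfold exF
  split_ifs with h
  · exact le_rfl
  · exact intervalIntegral.integral_nonneg (by linarith) fun u _ => exf_nonneg hα u

lemma exF_le_four {α x : ℝ} (hα : 0 < α) (hx : x ≤ 0) : exF α x ≤ 4 := by
  unfold exF
  split_ifs with h
  · norm_num
  · have := intervalIntegral.integral_mono_on (by linarith : (-2 : ℝ) ≤ x)
      (intervalIntegrable_exf hα _ _) (intervalIntegrable_const (c := (2 : ℝ)))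
      fun u _ => exf_le_two hα u
    simp only [intervalIntegral.integral_const, smul_eq_mul] at this
    linarith

lemma gaussian_exponent (x T : ℝ) : -x ^ 2 / (2 * T) = -(1 / (2 * T)) * x ^ 2 := by
  ring

open MeasureTheory in
lemma integrable_gaussian {T : ℝ} (hT : 0 < T) :
    Integrable fun x : ℝ => Real.exp (-x ^ 2 / (2 * T)) := by
  simp only [gaussian_exponent]
  exact integrable_exp_neg_mul_sq (by positivity)

lemma integral_gaussian_eq (T : ℝ) :
    ∫ x : ℝ, Real.exp (-x ^ 2 / (2 * T)) = √(2 * π * T) := by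
  simp only [gaussian_exponent]
  rw [integral_gaussian]
  congr 1
  rw [div_div_eq_mul_div]
  ring

open MeasureTheory in
lemma integrable_gaussian_exF {α T : ℝ} (hα : 0 < α) (hT : 0 < T) :
    Integrable fun x : ℝ => Real.exp (-x ^ 2 / (2 * T)) * Real.exp (-exF α (-x)) := by
  have := measurable_exF hα
  refine (integrable_gaussian hT).mono' (by fun_prop) (ae_of_all _ fun x => ?_)
  rw [Real.norm_of_nonneg (by positivity)]
  exact mul_le_of_le_one_right (by positivity)
    (Real.exp_le_one_iff.2 (neg_nonpos.2 (exF_nonneg hα _)))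

open MeasureTheory in
lemma integrable_gaussian_exF_exf {α T : ℝ} (hα : 0 < α) (hT : 0 < T) :
    Integrable fun x : ℝ =>
      Real.exp (-x ^ 2 / (2 * T)) * Real.exp (-exF α (-x)) * exf α (-x) := by
  have := measurable_exF hα
  have := measurable_exf α
  refine ((integrable_gaussian_exF hα hT).mul_const 2).mono' (by fun_prop)
    (ae_of_all _ fun x => ?_)
  have := exf_nonneg hα (-x)
  rw [Real.norm_of_nonneg (by positivity)]
  exact mul_le_mul_of_nonneg_left (exf_le_two hα _) (by positivity)

lemma denominator_pos {α T : ℝ} (hα : 0 < α) (hT : 0 < T) :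
    0 < ∫ x : ℝ, Real.exp (-x ^ 2 / (2 * T)) * Real.exp (-exF α (-x)) := by
  have h := integrable_gaussian_exF hα hT
  simp only [← Real.exp_add] at h ⊢
  exact MeasureTheory.integral_exp_pos h

lemma denominator_le {α T : ℝ} (hα : 0 < α) (hT : 0 < T) :
    ∫ x : ℝ, Real.exp (-x ^ 2 / (2 * T)) * Real.exp (-exF α (-x)) ≤ √(2 * π * T) := by
  rw [← integral_gaussian_eq]
  exact MeasureTheory.integral_mono (integrable_gaussian_exF hα hT) (integrable_gaussian hT)
    fun x => mul_le_of_le_one_right (by positivity)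
      (Real.exp_le_one_iff.2 (neg_nonpos.2 (exF_nonneg hα _)))

open MeasureTheory in
lemma integrable_gap {α T : ℝ} (hα : 0 < α) (hT : 0 < T) :
    Integrable fun x : ℝ =>
      Real.exp (-x ^ 2 / (2 * T)) * Real.exp (-exF α (-x)) * (2 - exf α (-x)) := by
  simp only [mul_sub]
  exact ((integrable_gaussian_exF hα hT).mul_const 2).sub (integrable_gaussian_exF_exf hα hT)

lemma gap_nonneg {α : ℝ} (hα : 0 < α) (T x : ℝ) :
    0 ≤ Real.exp (-x ^ 2 / (2 * T)) * Real.exp (-exF α (-x)) * (2 - exf α (-x)) :=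
  mul_nonneg (by positivity) (sub_nonneg.2 (exf_le_two hα _))

lemma two_sub_lamT {α T : ℝ} (hα : 0 < α) (hT : 0 < T) :
    2 - lamT α T =
      (∫ x : ℝ, Real.exp (-x ^ 2 / (2 * T)) * Real.exp (-exF α (-x)) * (2 - exf α (-x))) /
        ∫ x : ℝ, Real.exp (-x ^ 2 / (2 * T)) * Real.exp (-exF α (-x)) := by
  have hD := (denominator_pos hα hT).ne'
  simp only [mul_sub]
  rw [MeasureTheory.integral_sub ((integrable_gaussian_exF hα hT).mul_const 2)
    (integrable_gaussian_exF_exf hα hT), MeasureTheory.integral_mul_const, lamT, sub_div,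
    mul_div_cancel_left₀ _ hD]

lemma continuous_gaussian_rpow {α : ℝ} (hα : 0 < α) (T : ℝ) :
    Continuous fun x : ℝ => Real.exp (-x ^ 2 / (2 * T)) * x ^ (1 + α) :=
  (by fun_prop : Continuous fun x : ℝ => Real.exp (-x ^ 2 / (2 * T))).mul
    (Real.continuous_rpow_const (by linarith))

lemma integral_gap_ge {α T : ℝ} (hα : 0 < α) (hT : 0 < T) :
    Real.exp (-4) * (∫ x in (0 : ℝ)..1, Real.exp (-x ^ 2 / (2 * T)) * x ^ (1 + α)) ≤
      ∫ x : ℝ, Real.exp (-x ^ 2 / (2 * T)) * Real.exp (-exF α (-x)) * (2 - exf α (-x)) := by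
  have hi := integrable_gap hα hT
  calc Real.exp (-4) * (∫ x in (0 : ℝ)..1, Real.exp (-x ^ 2 / (2 * T)) * x ^ (1 + α))
      = ∫ x in (0 : ℝ)..1, Real.exp (-4) * (Real.exp (-x ^ 2 / (2 * T)) * x ^ (1 + α)) := by
        rw [intervalIntegral.integral_const_mul]
    _ ≤ ∫ x in (0 : ℝ)..1,
          Real.exp (-x ^ 2 / (2 * T)) * Real.exp (-exF α (-x)) * (2 - exf α (-x)) := by
        refine intervalIntegral.integral_mono_on zero_le_one
          ((continuous_gaussian_rpow hα T).const_mul _ |>.intervalIntegrable _ _)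
          hi.intervalIntegrable fun x hx => ?_
        rw [two_sub_exf_neg hx.1 hx.2, ← mul_assoc, mul_comm (Real.exp (-4))]
        have := Real.rpow_nonneg hx.1 (1 + α)
        have := exF_le_four hα (neg_nonpos.2 hx.1)
        gcongr
    _ ≤ _ := by
        rw [intervalIntegral.integral_of_le zero_le_one]
        exact MeasureTheory.setIntegral_le_integral hi (MeasureTheory.ae_of_all _ (gap_nonneg hα T))

lemma integral_gaussian_rpow_ge {α T : ℝ} (hα : 0 < α) (hT : T ∈ Set.Ioc (0 : ℝ) 1) :
    √T / 2 * (Real.exp (-1 / 2) * (√T / 2) ^ (1 + α)) ≤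
      ∫ x in (0 : ℝ)..1, Real.exp (-x ^ 2 / (2 * T)) * x ^ (1 + α) := by
  obtain ⟨h0, h1⟩ := hT
  have hs : 0 < √T := Real.sqrt_pos.2 h0
  have hs1 : √T ≤ 1 := Real.sqrt_le_one.2 h1
  have hc := continuous_gaussian_rpow hα T
  calc √T / 2 * (Real.exp (-1 / 2) * (√T / 2) ^ (1 + α))
      = ∫ _ in (√T / 2)..√T, Real.exp (-1 / 2) * (√T / 2) ^ (1 + α) := by
        rw [intervalIntegral.integral_const, smul_eq_mul]
        ring
    _ ≤ ∫ x in (√T / 2)..√T, Real.exp (-x ^ 2 / (2 * T)) * x ^ (1 + α) := by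
        refine intervalIntegral.integral_mono_on (by linarith) intervalIntegrable_const
          (hc.intervalIntegrable _ _) fun x hx => ?_
        have hx0 : 0 ≤ x := by linarith [hx.1]
        have hxT : x ^ 2 ≤ T := (Real.le_sqrt hx0 h0.le).1 hx.2
        have : -1 / 2 ≤ -x ^ 2 / (2 * T) := by
          rw [div_le_div_iff₀ two_pos (by positivity)]
          linarith
        have := hx.1
        gcongr
    _ ≤ _ := by
        refine intervalIntegral.integral_mono_interval (by linarith) (by linarith) hs1 ?_
          (hc.intervalIntegrable _ _)
        refine (MeasureTheory.ae_restrict_iff' measurableSet_Ioc).2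
          (MeasureTheory.ae_of_all _ fun x hx => ?_)
        exact mul_nonneg (by positivity) (Real.rpow_nonneg hx.1.le _)

lemma rpow_neg_half_eq {x : ℝ} (hx : 0 ≤ x) : x ^ (-(1 : ℝ) / 2) = (√x)⁻¹ := by
  rw [Real.sqrt_eq_rpow, ← Real.rpow_neg hx]
  norm_num

theorem stmt19 (α : ℝ) (hα : α ∈ Set.Ioo (0:ℝ) 1) :
    (∀ T ∈ Set.Ioc (0:ℝ) 1,
      lamT α T ≤ 2 ∧
      Real.exp (-4) * (2 * Real.pi * T) ^ (-(1:ℝ)/2) *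
          (∫ x in (0:ℝ)..1, Real.exp (-x ^ 2 / (2 * T)) * x ^ (1 + α)) ≤
        2 - lamT α T) ∧
    ∃ c > 0, ∀ T ∈ Set.Ioc (0:ℝ) 1, c * T ^ ((1 + α) / 2) ≤ 2 - lamT α T := by
  have hα0 := hα.1
  have key : ∀ T ∈ Set.Ioc (0:ℝ) 1,
      Real.exp (-4) * (2 * Real.pi * T) ^ (-(1:ℝ)/2) *
          (∫ x in (0:ℝ)..1, Real.exp (-x ^ 2 / (2 * T)) * x ^ (1 + α)) ≤
        2 - lamT α T := by
    intro T hT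
    have hT0 := hT.1
    rw [two_sub_lamT hα0 hT0, rpow_neg_half_eq (by positivity), mul_right_comm, ← div_eq_mul_inv]
    exact div_le_div₀ (MeasureTheory.integral_nonneg (gap_nonneg hα0 T))
      (integral_gap_ge hα0 hT0) (denominator_pos hα0 hT0) (denominator_le hα0 hT0)
  refine ⟨fun T hT => ⟨?_, key T hT⟩, ?_⟩
  · rw [← sub_nonneg, two_sub_lamT hα0 hT.1]
    exact div_nonneg (MeasureTheory.integral_nonneg (gap_nonneg hα0 T))
      (denominator_pos hα0 hT.1).le
  · refine ⟨Real.exp (-4) * (√(2 * π))⁻¹ * (1 / 2 * (Real.exp (-1 / 2) * (1 / 2) ^ (1 + α))),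
      by positivity, fun T hT => le_trans ?_ (key T hT)⟩
    have hT0 := hT.1
    have hs : 0 < √T := Real.sqrt_pos.2 hT0
    refine le_trans (le_of_eq ?_) (mul_le_mul_of_nonneg_left (integral_gaussian_rpow_ge hα0 hT)
      (by positivity))
    have hpow : (√T / 2) ^ (1 + α) = T ^ ((1 + α) / 2) * (1 / 2) ^ (1 + α) := by
      rw [div_eq_mul_one_div, Real.mul_rpow hs.le (by norm_num), Real.sqrt_eq_rpow,
        ← Real.rpow_mul hT0.le]
      ring_nf
    rw [hpow, rpow_neg_half_eq (by positivity), Real.sqrt_mul (by positivity) T]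
    field_simp
end
end
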